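/- Let g = θ∘λ : Sⁿ → (−∞,∞] be a lower semicontinuous convex spectral function with θ symmetric, and let Y ∈ ∂g(X) with U ∈ Oⁿ(X) ∩ Oⁿ(Y) a common ordered eigenbasis. If H ∈ K_g(X,Y) (the critical cone of g at X for Y), then λ′(X;H) ∈ K_θ(λ(X), λ(Y)) and, for each m, the matrices Λ(Y)_{α_m α_m} and U_{α_m}ᵀ H U_{α_m} admit a simultaneous ordered spectral decomposition; conversely these two conditions imply H ∈ K_g(X,Y). -/

import Mathlib

open Filter Topology Set Matrix

noncomputable section

def IsEigVec {n : ℕ} (X : Matrix (Fin n) (Fin n) ℝ) (a : Fin n → ℝ) : Prop :=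
  (∀ i j : Fin n, i ≤ j → a j ≤ a i) ∧
    ∃ U : Matrix (Fin n) (Fin n) ℝ, U * Uᵀ = 1 ∧ X = U * Matrix.diagonal a * Uᵀ

def vnorm {n : ℕ} (x : Fin n → ℝ) : ℝ := Real.sqrt (∑ i, (x i) ^ 2)

def fnorm {n : ℕ} (A : Matrix (Fin n) (Fin n) ℝ) : ℝ := Real.sqrt (∑ i, ∑ j, (A i j) ^ 2)

def mInner {n : ℕ} (A B : Matrix (Fin n) (Fin n) ℝ) : ℝ := Matrix.trace (A * B)

def subderiv {E : Type*} [AddCommGroup E] [Module ℝ E] [TopologicalSpace E]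
    (f : E → EReal) (x w : E) : EReal :=
  Filter.liminf (fun p : ℝ × E => (((p.1)⁻¹ : ℝ) : EReal) * (f (x + p.1 • p.2) - f x))
    ((nhdsWithin (0 : ℝ) (Set.Ioi 0)) ×ˢ nhds w)

def subderiv2With {E : Type*} [AddCommGroup E] [Module ℝ E] [TopologicalSpace E]
    (ip : E → E → ℝ) (f : E → EReal) (x v w : E) : EReal :=
  Filter.liminf (fun p : ℝ × E =>
      ((2 / p.1 ^ 2 : ℝ) : EReal) * (f (x + p.1 • p.2) - f x - ((p.1 * ip v p.2 : ℝ) : EReal)))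
    ((nhdsWithin (0 : ℝ) (Set.Ioi 0)) ×ˢ nhds w)

def parabSubderiv {E : Type*} [AddCommGroup E] [Module ℝ E] [TopologicalSpace E]
    (f : E → EReal) (x w : E) (dfw : ℝ) (z : E) : EReal :=
  Filter.liminf (fun p : ℝ × E =>
      ((2 / p.1 ^ 2 : ℝ) : EReal) *
        (f (x + p.1 • w + (p.1 ^ 2 / 2) • p.2) - f x - ((p.1 * dfw : ℝ) : EReal)))
    ((nhdsWithin (0 : ℝ) (Set.Ioi 0)) ×ˢ nhds z)

def tcone {E : Type*} [AddCommGroup E] [Module ℝ E] [TopologicalSpace E]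
    (C : Set E) (x : E) : Set E :=
  {w | ∃ (t : ℕ → ℝ) (v : ℕ → E), (∀ k, 0 < t k) ∧ Filter.Tendsto t Filter.atTop (nhds 0) ∧
      Filter.Tendsto v Filter.atTop (nhds w) ∧ ∀ k, x + t k • v k ∈ C}

def tcone2 {E : Type*} [AddCommGroup E] [Module ℝ E] [TopologicalSpace E]
    (C : Set E) (x w : E) : Set E :=
  {u | ∃ (t : ℕ → ℝ) (v : ℕ → E), (∀ k, 0 < t k) ∧ Filter.Tendsto t Filter.atTop (nhds 0) ∧
      Filter.Tendsto v Filter.atTop (nhds u) ∧ ∀ k, x + t k • w + (t k ^ 2 / 2) • v k ∈ C}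

/-- Two symmetric matrices admit a simultaneous ordered spectral decomposition. -/
def SimOrdDecomp {ι : Type*} [Fintype ι] [LinearOrder ι] [DecidableEq ι]
    (A B : Matrix ι ι ℝ) : Prop :=
  ∃ (Q : Matrix ι ι ℝ) (a b : ι → ℝ), Q * Qᵀ = 1 ∧
    (∀ i j : ι, i ≤ j → a j ≤ a i) ∧ (∀ i j : ι, i ≤ j → b j ≤ b i) ∧
    A = Q * Matrix.diagonal a * Qᵀ ∧ B = Q * Matrix.diagonal b * Qᵀ


section Fan

variable {ι : Type*} [Fintype ι]

omit [Fintype ι] in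
theorem antitone_monovary [LinearOrder ι] {a b : ι → ℝ} (ha : ∀ i j, i ≤ j → a j ≤ a i)
    (hb : ∀ i j, i ≤ j → b j ≤ b i) : Monovary a b :=
  (show Antitone a from fun i j h => ha i j h).monovary (fun i j h => hb i j h)

variable [DecidableEq ι]

theorem transpose_mul_self_of_orthogonal {W : Matrix ι ι ℝ} (hW : W * Wᵀ = 1) : Wᵀ * W = 1 :=
  mul_eq_one_comm.mp hW

theorem mul_transpose_orthogonal {V W : Matrix ι ι ℝ} (hV : V * Vᵀ = 1) (hW : W * Wᵀ = 1) :
    (Vᵀ * W) * (Vᵀ * W)ᵀ = 1 := by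
  rw [transpose_mul, transpose_transpose,
    show Vᵀ * W * (Wᵀ * V) = Vᵀ * (W * Wᵀ) * V by simp only [Matrix.mul_assoc], hW,
    Matrix.mul_one, transpose_mul_self_of_orthogonal hV]

theorem sum_sq_row_of_orthogonal {W : Matrix ι ι ℝ} (hW : W * Wᵀ = 1) (i : ι) :
    ∑ j, W i j ^ 2 = 1 := by
  have := congrFun (congrFun hW i) i
  simpa [Matrix.mul_apply, sq] using this

theorem sum_sq_col_of_orthogonal {W : Matrix ι ι ℝ} (hW : W * Wᵀ = 1) (j : ι) :
    ∑ i, W i j ^ 2 = 1 := by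
  have := congrFun (congrFun (transpose_mul_self_of_orthogonal hW) j) j
  simpa [Matrix.mul_apply, sq] using this

theorem abs_entry_le_one_of_orthogonal {W : Matrix ι ι ℝ} (hW : W * Wᵀ = 1) (i j : ι) :
    |W i j| ≤ 1 := by
  rw [← sq_le_one_iff_abs_le_one, ← sum_sq_row_of_orthogonal hW i]
  exact Finset.single_le_sum (f := fun j => W i j ^ 2) (fun _ _ => sq_nonneg _)
    (Finset.mem_univ j)

theorem conj_diagonal_apply (W : Matrix ι ι ℝ) (b : ι → ℝ) (i j : ι) :
    (W * diagonal b * Wᵀ) i j = ∑ k, W i k * b k * W j k := by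
  rw [Matrix.mul_apply]
  simp only [Matrix.mul_diagonal, transpose_apply]

theorem isSymm_conj_diagonal (W : Matrix ι ι ℝ) (b : ι → ℝ) :
    (W * diagonal b * Wᵀ).IsSymm := by
  simp [Matrix.IsSymm, transpose_mul, Matrix.mul_assoc]

theorem trace_mul_eq_of_conj {V A B : Matrix ι ι ℝ} (hV : V * Vᵀ = 1) :
    trace (Vᵀ * A * V * (Vᵀ * B * V)) = trace (A * B) := by
  rw [show Vᵀ * A * V * (Vᵀ * B * V) = Vᵀ * (A * (V * Vᵀ) * B * V) by
    simp only [Matrix.mul_assoc], hV, trace_mul_comm, Matrix.mul_one, Matrix.mul_assoc, hV,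
    Matrix.mul_one]

theorem trace_conj_diagonal_mul_same {V : Matrix ι ι ℝ} (hV : V * Vᵀ = 1) (a b : ι → ℝ) :
    trace (V * diagonal a * Vᵀ * (V * diagonal b * Vᵀ)) = ∑ i, a i * b i := by
  have := trace_mul_eq_of_conj (A := diagonal a) (B := diagonal b) (V := Vᵀ)
    (by rw [transpose_transpose]; exact transpose_mul_self_of_orthogonal hV)
  rw [transpose_transpose] at this
  rw [this, diagonal_mul_diagonal, trace_diagonal]

variable [LinearOrder ι]

/-- Fan's inequality, with one of the two matrices diagonal. -/
theorem sum_mul_diag_conj_le {a b : ι → ℝ} (ha : ∀ i j, i ≤ j → a j ≤ a i)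
    (hb : ∀ i j, i ≤ j → b j ≤ b i) {W : Matrix ι ι ℝ} (hW : W * Wᵀ = 1) :
    ∑ i, a i * (W * diagonal b * Wᵀ) i i ≤ ∑ i, a i * b i := by
  have hmem : (Matrix.of fun i j => W i j ^ 2) ∈ doublyStochastic ℝ ι := by
    rw [mem_doublyStochastic_iff_sum]
    exact ⟨fun i j => sq_nonneg _, sum_sq_row_of_orthogonal hW, sum_sq_col_of_orthogonal hW⟩
  obtain ⟨w, hw0, hw1, hw⟩ := exists_eq_sum_perm_of_mem_doublyStochastic hmem
  have hentry : ∀ i j, W i j ^ 2 = ∑ σ : Equiv.Perm ι, w σ * if σ i = j then 1 else 0 := by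
    intro i j
    have := congrFun (congrFun hw i) j
    rw [Matrix.sum_apply] at this
    simpa [Equiv.Perm.permMatrix, PEquiv.toMatrix_apply, eq_comm] using this.symm
  have hrow : ∀ i, (W * diagonal b * Wᵀ) i i = ∑ σ : Equiv.Perm ι, w σ * b (σ i) := by
    intro i
    rw [conj_diagonal_apply]
    calc ∑ k, W i k * b k * W i k
        = ∑ k, ∑ σ : Equiv.Perm ι, (w σ * if σ i = k then 1 else 0) * b k :=
          Finset.sum_congr rfl fun k _ => by rw [← Finset.sum_mul, ← hentry]; ring
      _ = _ := by rw [Finset.sum_comm]; simp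
  calc ∑ i, a i * (W * diagonal b * Wᵀ) i i
      = ∑ σ : Equiv.Perm ι, w σ * ∑ i, a i * b (σ i) := by
        simp only [hrow, Finset.mul_sum]
        rw [Finset.sum_comm]
        exact Finset.sum_congr rfl fun _ _ => Finset.sum_congr rfl fun _ _ => by ring
    _ ≤ ∑ σ : Equiv.Perm ι, w σ * ∑ i, a i * b i :=
        Finset.sum_le_sum fun σ _ => mul_le_mul_of_nonneg_left
          (antitone_monovary ha hb).sum_mul_comp_perm_le_sum_mul (hw0 σ)
    _ = ∑ i, a i * b i := by rw [← Finset.sum_mul, hw1, one_mul]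

/-- Fan's inequality. -/
theorem trace_conj_diagonal_mul_le {a b : ι → ℝ} (ha : ∀ i j, i ≤ j → a j ≤ a i)
    (hb : ∀ i j, i ≤ j → b j ≤ b i) {V W : Matrix ι ι ℝ} (hV : V * Vᵀ = 1)
    (hW : W * Wᵀ = 1) :
    trace (V * diagonal a * Vᵀ * (W * diagonal b * Wᵀ)) ≤ ∑ i, a i * b i := by
  have h1 := sum_mul_diag_conj_le ha hb (mul_transpose_orthogonal hV hW)
  have h2 : trace (V * diagonal a * Vᵀ * (W * diagonal b * Wᵀ))
      = trace (diagonal a * ((Vᵀ * W) * diagonal b * (Vᵀ * W)ᵀ)) := by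
    rw [transpose_mul, transpose_transpose, trace_mul_comm, ← Matrix.mul_assoc, trace_mul_comm,
      ← Matrix.mul_assoc, ← Matrix.mul_assoc, trace_mul_comm]
    simp only [Matrix.mul_assoc]
  rw [h2]
  simpa [trace, diagonal_mul] using h1

/-- The Hoffman–Wielandt inequality. -/
theorem sum_sq_sub_le_trace {a b : ι → ℝ} (ha : ∀ i j, i ≤ j → a j ≤ a i)
    (hb : ∀ i j, i ≤ j → b j ≤ b i) {V W A B : Matrix ι ι ℝ} (hV : V * Vᵀ = 1)
    (hW : W * Wᵀ = 1) (hA : A = V * diagonal a * Vᵀ) (hB : B = W * diagonal b * Wᵀ) :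
    ∑ i, (a i - b i) ^ 2 ≤ trace ((A - B) * (A - B)) := by
  have h1 : trace (A * A) = ∑ i, a i * a i := by rw [hA, trace_conj_diagonal_mul_same hV]
  have h2 : trace (B * B) = ∑ i, b i * b i := by rw [hB, trace_conj_diagonal_mul_same hW]
  have h3 : trace (A * B) ≤ ∑ i, a i * b i := by
    rw [hA, hB]; exact trace_conj_diagonal_mul_le ha hb hV hW
  have h4 : ∑ i, (a i - b i) ^ 2
      = ∑ i, a i * a i + ∑ i, b i * b i - 2 * ∑ i, a i * b i := by
    rw [Finset.mul_sum, ← Finset.sum_add_distrib, ← Finset.sum_sub_distrib]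
    exact Finset.sum_congr rfl fun _ _ => by ring
  rw [Matrix.sub_mul, Matrix.mul_sub, Matrix.mul_sub, trace_sub, trace_sub, trace_sub,
    trace_mul_comm B A, h4]
  linarith

omit [LinearOrder ι] in
/-- Two diagonal matrices that are orthogonally conjugate agree up to a permutation. -/
theorem exists_perm_of_conj_diagonal_eq {a b : ι → ℝ} {V W : Matrix ι ι ℝ} (hV : V * Vᵀ = 1)
    (hW : W * Wᵀ = 1) (h : V * diagonal a * Vᵀ = W * diagonal b * Wᵀ) :
    ∃ σ : Equiv.Perm ι, a = b ∘ σ := by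
  have key : ∀ {c : ι → ℝ} {Q : Matrix ι ι ℝ}, Q * Qᵀ = 1 →
      (Q * diagonal c * Qᵀ).charpoly.roots = Finset.univ.val.map c := by
    intro c Q hQ
    rw [charpoly_mul_comm, ← Matrix.mul_assoc, transpose_mul_self_of_orthogonal hQ,
      Matrix.one_mul, charpoly_diagonal, Polynomial.roots_prod]
    · simp
    · simp [Finset.prod_ne_zero_iff, Polynomial.X_sub_C_ne_zero]
  have hm : Finset.univ.val.map a = Finset.univ.val.map b := by
    rw [← key hV, ← key hW, h]
  have hcard : ∀ c : ℝ, Nonempty ({i // a i = c} ≃ {i // b i = c}) := by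
    intro c
    have := congrArg (Multiset.count c) hm
    rw [Multiset.count_map, Multiset.count_map] at this
    refine Fintype.card_eq.mp ?_
    rw [Fintype.card_subtype, Fintype.card_subtype]
    simpa [Finset.card_def, eq_comm] using this
  exact ⟨Equiv.ofFiberEquiv fun c => (hcard c).some,
    funext fun i => (Equiv.ofFiberEquiv_map _ i).symm⟩

omit [DecidableEq ι] in
theorem exists_perm_comp_antitone (f : ι → ℝ) :
    ∃ σ : Equiv.Perm ι, ∀ i j, i ≤ j → f (σ j) ≤ f (σ i) := by
  let e := (Fintype.orderIsoFinOfCardEq ι rfl).symm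
  let s := Tuple.sort (fun k => -f (e.symm k))
  refine ⟨e.toEquiv.trans (s.trans e.symm.toEquiv), fun i j hij => ?_⟩
  have := Tuple.monotone_sort (fun k => -f (e.symm k)) (e.monotone hij)
  simpa [s] using this

theorem exists_sorted_spectral_decomposition {A : Matrix ι ι ℝ} (hA : A.IsSymm) :
    ∃ (Q : Matrix ι ι ℝ) (c : ι → ℝ), Q * Qᵀ = 1 ∧ (∀ i j, i ≤ j → c j ≤ c i) ∧
      A = Q * diagonal c * Qᵀ := by
  have hH : A.IsHermitian := by rwa [IsHermitian, conjTranspose_eq_transpose_of_trivial]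
  obtain ⟨σ, hσ⟩ := exists_perm_comp_antitone hH.eigenvalues
  let P : Matrix ι ι ℝ := hH.eigenvectorUnitary
  have hP : P * Pᵀ = 1 := by
    have := (Matrix.mem_unitaryGroup_iff).mp hH.eigenvectorUnitary.2
    rwa [star_eq_conjTranspose, conjTranspose_eq_transpose_of_trivial] at this
  have hAP : A = P * diagonal hH.eigenvalues * Pᵀ := by
    have := hH.spectral_theorem
    rw [Unitary.conjStarAlgAut_apply, star_eq_conjTranspose,
      conjTranspose_eq_transpose_of_trivial] at this
    exact this
  refine ⟨P.submatrix id σ, hH.eigenvalues ∘ σ, ?_, hσ, ?_⟩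
  · rw [transpose_submatrix, submatrix_mul_equiv, hP, submatrix_id_id]
  · rw [← submatrix_diagonal_equiv, submatrix_mul_equiv, transpose_submatrix, submatrix_mul_equiv,
      ← hAP, submatrix_id_id]

/-- The equality case of Fan's inequality, with one of the two matrices diagonal. -/
theorem sum_mul_diag_conj_eq_iff {a b : ι → ℝ} (ha : ∀ i j, i ≤ j → a j ≤ a i)
    (hb : ∀ i j, i ≤ j → b j ≤ b i) {W B : Matrix ι ι ℝ} (hW : W * Wᵀ = 1)
    (hB : B = W * diagonal b * Wᵀ) :
    ∑ i, a i * B i i = ∑ i, a i * b i ↔ SimOrdDecomp (diagonal a) B := by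
  have htr : ∀ M : Matrix ι ι ℝ, trace (diagonal a * M) = ∑ i, a i * M i i := fun M => by
    simp [trace, diagonal_mul]
  constructor
  · intro heq
    have hBs : B.IsSymm := hB ▸ isSymm_conj_diagonal W b
    obtain ⟨Q, c, hQ, hc, hQc⟩ :=
      exists_sorted_spectral_decomposition ((isSymm_diagonal a).add hBs)
    have hAA : trace (diagonal a * diagonal a) = ∑ i, a i * a i := by
      rw [diagonal_mul_diagonal, trace_diagonal]
    have hBB : trace (B * B) = ∑ i, b i * b i := by
      rw [hB, trace_conj_diagonal_mul_same hW]
    have hAB : trace (diagonal a * B) = ∑ i, a i * b i := by rw [htr, heq]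
    have hcc : ∑ i, c i * c i = ∑ i, a i * a i + ∑ i, b i * b i + 2 * ∑ i, a i * b i := by
      rw [← trace_conj_diagonal_mul_same hQ, ← hQc, Matrix.add_mul, Matrix.mul_add,
        Matrix.mul_add, trace_add, trace_add, trace_add, trace_mul_comm B, hAA, hBB, hAB]
      ring
    have hac : trace (diagonal a * (diagonal a + B)) ≤ ∑ i, a i * c i := by
      rw [hQc, htr]
      exact sum_mul_diag_conj_le ha hc hQ
    have hbc : trace (B * (diagonal a + B)) ≤ ∑ i, b i * c i := by
      rw [hQc, hB]
      exact trace_conj_diagonal_mul_le hb hc hW hQ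
    have hsq : ∑ i, (c i - (a i + b i)) ^ 2 = ∑ i, c i * c i + ∑ i, a i * a i + ∑ i, b i * b i
        + 2 * ∑ i, a i * b i - 2 * ∑ i, a i * c i - 2 * ∑ i, b i * c i := by
      simp only [Finset.mul_sum, ← Finset.sum_add_distrib, ← Finset.sum_sub_distrib]
      exact Finset.sum_congr rfl fun _ _ => by ring
    rw [Matrix.mul_add, trace_add, hAA, hAB] at hac
    rw [Matrix.mul_add, trace_add, trace_mul_comm B, hBB, hAB] at hbc
    have hc_eq : ∀ i, c i = a i + b i := by
      have h0 : ∑ i, (c i - (a i + b i)) ^ 2 = 0 :=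
        le_antisymm (by rw [hsq]; linarith) (Finset.sum_nonneg fun _ _ => sq_nonneg _)
      intro i
      have := (Finset.sum_eq_zero_iff_of_nonneg fun _ _ => sq_nonneg _).mp h0 i
        (Finset.mem_univ i)
      have := pow_eq_zero_iff (two_ne_zero) |>.mp this
      linarith
    have hcd : diagonal c = diagonal a + diagonal b := by
      rw [diagonal_add]; exact congrArg _ (funext hc_eq)
    -- Fan's inequality for `diagonal a` against both summands of `c = a + b` must be tight.
    have h1 : trace (diagonal a * (Q * diagonal a * Qᵀ)) ≤ ∑ i, a i * a i :=
      (htr _).trans_le (sum_mul_diag_conj_le ha ha hQ)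
    have h2 : trace (diagonal a * (Q * diagonal b * Qᵀ)) ≤ ∑ i, a i * b i :=
      (htr _).trans_le (sum_mul_diag_conj_le ha hb hQ)
    have h3 : trace (diagonal a * (Q * diagonal a * Qᵀ))
        + trace (diagonal a * (Q * diagonal b * Qᵀ)) = ∑ i, a i * a i + ∑ i, a i * b i := by
      rw [← trace_add, ← Matrix.mul_add, ← Matrix.add_mul, ← Matrix.mul_add, ← hcd, ← hQc,
        Matrix.mul_add, trace_add, hAA, hAB]
    have hD : diagonal a = Q * diagonal a * Qᵀ := by
      set D := diagonal a - Q * diagonal a * Qᵀ with hDdef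
      have hDs : Dᵀ = D := (isSymm_diagonal a).sub (isSymm_conj_diagonal Q a)
      have htD : trace (Dᵀ * D) = 0 := by
        rw [hDs, hDdef, Matrix.sub_mul, Matrix.mul_sub, Matrix.mul_sub, trace_sub, trace_sub,
          trace_sub, trace_conj_diagonal_mul_same hQ, trace_mul_comm (Q * diagonal a * Qᵀ), hAA]
        linarith
      have : D = 0 := by
        ext i j
        have h0 : ∑ j, ∑ i, D i j ^ 2 = 0 := by
          simpa [trace, Matrix.mul_apply, sq] using htD
        have h1 := (Finset.sum_eq_zero_iff_of_nonneg fun _ _ =>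
          Finset.sum_nonneg fun _ _ => sq_nonneg _).mp h0 j (Finset.mem_univ j)
        have h2 := (Finset.sum_eq_zero_iff_of_nonneg fun _ _ => sq_nonneg _).mp h1 i
          (Finset.mem_univ i)
        exact pow_eq_zero_iff two_ne_zero |>.mp h2
      exact sub_eq_zero.mp this
    refine ⟨Q, a, b, hQ, ha, hb, hD, ?_⟩
    rw [hcd, Matrix.mul_add, Matrix.add_mul, ← hD] at hQc
    exact add_left_cancel hQc
  · rintro ⟨Q, a', b', hQ, ha', hb', hAQ, hBQ⟩
    obtain ⟨σ, hσ⟩ := exists_perm_of_conj_diagonal_eq (V := 1) (a := a) (by simp) hQ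
      (by simpa using hAQ)
    obtain ⟨τ, hτ⟩ := exists_perm_of_conj_diagonal_eq hW hQ (hB ▸ hBQ)
    have h1 : ∑ i, a i * B i i = ∑ i, a' i * b' i := by
      rw [← htr, hAQ, hBQ, trace_conj_diagonal_mul_same hQ]
    refine le_antisymm (hB ▸ sum_mul_diag_conj_le ha hb hW) ?_
    rw [h1]
    calc ∑ i, a i * b i = ∑ i, a' i * b' ((σ.symm.trans τ) i) := by
          rw [hσ, hτ, ← Equiv.sum_comp σ fun i => a' i * b' ((σ.symm.trans τ) i)]
          simp
      _ ≤ _ := (antitone_monovary ha' hb').sum_mul_comp_perm_le_sum_mul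

end Fan

section Limit

variable {ι : Type*} [Fintype ι] [DecidableEq ι]

/-- Along the path `diagonal x + t • K`, ordered eigenbases accumulate at an orthogonal matrix that
is block diagonal with respect to `x` and diagonalizes the diagonal blocks of `K`, the eigenvalues
being the directional derivatives `d`. -/
theorem exists_limit_eigenbasis {x d : ι → ℝ} {K : Matrix ι ι ℝ} {l : ℝ → ι → ℝ}
    {W : ℝ → Matrix ι ι ℝ} (hW : ∀ t, W t * (W t)ᵀ = 1)
    (hdec : ∀ t, (diagonal x + t • K) * W t = W t * diagonal (l t))
    (hd : ∀ i, Tendsto (fun t => (l t i - x i) / t) (𝓝[>] 0) (𝓝 (d i))) :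
    ∃ Q : Matrix ι ι ℝ, Q * Qᵀ = 1 ∧ (∀ k i, x k ≠ x i → Q k i = 0) ∧
      ∀ k i, x k = x i → (K * Q) k i = d i * Q k i := by
  let F : Ultrafilter ℝ := Ultrafilter.of (𝓝[>] 0)
  have hF : (F : Filter ℝ) ≤ 𝓝[>] 0 := Ultrafilter.of_le _
  have hlim : ∀ k i, ∃ q : ℝ, Tendsto (fun t => W t k i) F (𝓝 q) := by
    intro k i
    obtain ⟨q, -, hq⟩ := (isCompact_Icc (a := (-1 : ℝ)) (b := 1)).ultrafilter_le_nhds'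
      (F.map fun t => W t k i)
      (Ultrafilter.mem_map.mpr <| Filter.univ_mem' fun t =>
        abs_le.mp (abs_entry_le_one_of_orthogonal (hW t) k i))
    exact ⟨q, hq⟩
  choose q hq using hlim
  let Q : Matrix ι ι ℝ := Matrix.of q
  have hpos : ∀ᶠ t in (F : Filter ℝ), 0 < t := hF self_mem_nhdsWithin
  have ht0 : Tendsto (fun t : ℝ => t) F (𝓝 0) := hF.trans nhdsWithin_le_nhds
  have hl : ∀ i, Tendsto (fun t => l t i) F (𝓝 (x i)) := by
    intro i
    have h1 : Tendsto (fun t => (l t i - x i) / t * t + x i) F (𝓝 (d i * 0 + x i)) :=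
      (((hd i).mono_left hF).mul ht0).add_const _
    rw [mul_zero, zero_add] at h1
    refine h1.congr' ?_
    filter_upwards [hpos] with t ht
    field_simp
    ring
  have hKW : ∀ k i, Tendsto (fun t => (K * W t) k i) F (𝓝 ((K * Q) k i)) := by
    intro k i
    simp only [Matrix.mul_apply]
    exact tendsto_finsetSum _ fun j _ => (hq j i).const_mul _
  have hentry : ∀ t k i, x k * W t k i + t * (K * W t) k i = W t k i * l t i := by
    intro t k i
    have := congrFun (congrFun (hdec t) k) i
    rwa [Matrix.add_mul, Matrix.add_apply, Matrix.diagonal_mul, Matrix.smul_mul,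
      Matrix.smul_apply, smul_eq_mul, Matrix.mul_diagonal] at this
  refine ⟨Q, ?_, fun k i hki => ?_, fun k i hki => ?_⟩
  · ext i j
    have h1 : Tendsto (fun t => (W t * (W t)ᵀ) i j) F (𝓝 ((Q * Qᵀ) i j)) := by
      simp only [Matrix.mul_apply, transpose_apply]
      exact tendsto_finsetSum _ fun k _ => (hq i k).mul (hq j k)
    simp only [hW] at h1
    exact tendsto_nhds_unique h1 tendsto_const_nhds
  · have h1 : Tendsto (fun t => x k * W t k i + t * (K * W t) k i) F
        (𝓝 (x k * q k i + 0 * (K * Q) k i)) := ((hq k i).const_mul _).add (ht0.mul (hKW k i))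
    simp only [hentry] at h1
    have h2 := tendsto_nhds_unique h1 ((hq k i).mul (hl i))
    have h3 : (x k - x i) * q k i = 0 := by linarith
    exact (mul_eq_zero.mp h3).resolve_left (sub_ne_zero.mpr hki)
  · have h1 : Tendsto (fun t => (l t i - x i) / t * W t k i) F (𝓝 (d i * q k i)) :=
      ((hd i).mono_left hF).mul (hq k i)
    refine tendsto_nhds_unique (hKW k i) (h1.congr' ?_)
    filter_upwards [hpos] with t ht
    have := hentry t k i
    rw [hki] at this
    rw [div_mul_eq_mul_div, div_eq_iff ht.ne']
    linarith

omit [DecidableEq ι] in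
theorem sum_block_eq {x : ι → ℝ} {μ : ℝ} {f : ι → ℝ} (hf : ∀ j, x j ≠ μ → f j = 0) :
    ∑ j : {j : ι // x j = μ}, f j = ∑ j, f j := by
  rw [← Finset.sum_subtype (Finset.univ.filter fun j => x j = μ) (by simp) f]
  exact Finset.sum_filter_of_ne fun j _ hj => by_contra fun h => hj (hf j h)

/-- Summing Fan's inequality over the blocks of `x`, together with its equality case. -/
theorem sum_mul_diag_le_and_eq_iff_blocks [LinearOrder ι] {x y d : ι → ℝ} {K Q : Matrix ι ι ℝ}
    (hy : ∀ i j, i ≤ j → y j ≤ y i) (hd : ∀ i j, x i = x j → i ≤ j → d j ≤ d i)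
    (hQ : Q * Qᵀ = 1) (hQ0 : ∀ k i, x k ≠ x i → Q k i = 0)
    (hKQ : ∀ k i, x k = x i → (K * Q) k i = d i * Q k i) :
    ∑ i, y i * K i i ≤ ∑ i, y i * d i ∧
      (∑ i, y i * K i i = ∑ i, y i * d i ↔
        ∀ μ : ℝ, SimOrdDecomp
          ((Matrix.diagonal y).submatrix
            (fun i : {i : ι // x i = μ} => (i : ι)) (fun j : {i : ι // x i = μ} => (j : ι)))
          (K.submatrix
            (fun i : {i : ι // x i = μ} => (i : ι)) (fun j : {i : ι // x i = μ} => (j : ι)))) := by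
  have hblock : ∀ μ : ℝ, ∃ R : Matrix {i : ι // x i = μ} {i : ι // x i = μ} ℝ, R * Rᵀ = 1 ∧
      K.submatrix (fun i : {i : ι // x i = μ} => (i : ι)) (fun j : {i : ι // x i = μ} => (j : ι))
        = R * diagonal (fun i : {i : ι // x i = μ} => d i) * Rᵀ := by
    intro μ
    let R := Q.submatrix (fun i : {i : ι // x i = μ} => (i : ι))
      (fun j : {i : ι // x i = μ} => (j : ι))
    have hR : R * Rᵀ = 1 := by
      ext i j
      have h1 := congrFun (congrFun hQ i) j
      rw [Matrix.mul_apply] at h1 ⊢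
      rw [Matrix.one_apply] at h1 ⊢
      simp only [Subtype.ext_iff]
      rw [← h1]
      exact sum_block_eq (f := fun k => Q i k * Q j k) fun k hk => by
        rw [hQ0 i k (by rw [i.2]; exact hk.symm), zero_mul]
    refine ⟨R, hR, ?_⟩
    have hKR : K.submatrix (fun i : {i : ι // x i = μ} => (i : ι))
        (fun j : {i : ι // x i = μ} => (j : ι)) * R
        = R * diagonal (fun i : {i : ι // x i = μ} => d i) := by
      ext k i
      have h1 := hKQ k i (k.2.trans i.2.symm)
      rw [Matrix.mul_apply] at h1 ⊢
      rw [Matrix.mul_diagonal, mul_comm]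
      refine Eq.trans ?_ h1
      exact sum_block_eq (f := fun j => K k j * Q j i) fun j hj => by
        rw [hQ0 j i (by rw [i.2]; exact hj), mul_zero]
    rw [← hKR, Matrix.mul_assoc, hR, Matrix.mul_one]
  have hle : ∀ μ : ℝ, ∑ i : {i : ι // x i = μ}, y i * K i i ≤
      ∑ i : {i : ι // x i = μ}, y i * d i := by
    intro μ
    obtain ⟨R, hR, hKR⟩ := hblock μ
    have := sum_mul_diag_conj_le (a := fun i : {i : ι // x i = μ} => y i)
      (b := fun i : {i : ι // x i = μ} => d i) (fun i j h => hy i j h)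
      (fun i j h => hd i j (i.2.trans j.2.symm) h) hR
    rwa [← hKR] at this
  have hiff : ∀ μ : ℝ, ∑ i : {i : ι // x i = μ}, y i * K i i =
      ∑ i : {i : ι // x i = μ}, y i * d i ↔ SimOrdDecomp
          ((Matrix.diagonal y).submatrix
            (fun i : {i : ι // x i = μ} => (i : ι)) (fun j : {i : ι // x i = μ} => (j : ι)))
          (K.submatrix
            (fun i : {i : ι // x i = μ} => (i : ι))
            (fun j : {i : ι // x i = μ} => (j : ι))) := by
    intro μ
    obtain ⟨R, hR, hKR⟩ := hblock μ
    rw [submatrix_diagonal _ _ Subtype.val_injective]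
    exact sum_mul_diag_conj_eq_iff (a := fun i : {i : ι // x i = μ} => y i)
      (fun i j h => hy i j h) (fun i j h => hd i j (i.2.trans j.2.symm) h) hR hKR
  have hfiber : ∀ f : ι → ℝ,
      ∑ i, f i = ∑ μ ∈ Finset.univ.image x, ∑ i : {i : ι // x i = μ}, f i := by
    intro f
    rw [← Finset.sum_fiberwise_of_maps_to (g := x) (t := Finset.univ.image x)
      (fun i _ => Finset.mem_image_of_mem x (Finset.mem_univ i))]
    exact Finset.sum_congr rfl fun μ _ => Finset.sum_subtype _ (by simp) _
  rw [hfiber fun i => y i * K i i, hfiber fun i => y i * d i]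
  refine ⟨Finset.sum_le_sum fun μ _ => hle μ, ?_⟩
  rw [Finset.sum_eq_sum_iff_of_le fun μ _ => hle μ]
  constructor
  · intro h μ
    rw [← hiff]
    by_cases hμ : μ ∈ Finset.univ.image x
    · exact h μ hμ
    · have : IsEmpty {i : ι // x i = μ} :=
        ⟨fun i => hμ (i.2 ▸ Finset.mem_image_of_mem x (Finset.mem_univ _))⟩
      simp
  · exact fun h μ _ => (hiff μ).mpr (h μ)

end Limit

section Subderivative

theorem EReal.inv_coe_mul_top_sub {t : ℝ} (ht : 0 < t) (c : ℝ) :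
    ((t⁻¹ : ℝ) : EReal) * (⊤ - (c : EReal)) = ⊤ := by
  rw [EReal.top_sub_coe, EReal.coe_mul_top_of_pos (inv_pos.mpr ht)]

theorem subderiv_le_of_tendsto {E F : Type*} [AddCommGroup E] [Module ℝ E] [TopologicalSpace E]
    [AddCommGroup F] [Module ℝ F] [TopologicalSpace F] {f : E → EReal} {x w : E} {h : F → EReal}
    {z v : F} {φ : ℝ × F → E} (hφ : Tendsto φ (𝓝[>] (0 : ℝ) ×ˢ 𝓝 v) (𝓝 w))
    (hle : ∀ p : ℝ × F, 0 < p.1 → (((p.1)⁻¹ : ℝ) : EReal) * (f (x + p.1 • φ p) - f x) ≤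
      (((p.1)⁻¹ : ℝ) : EReal) * (h (z + p.1 • p.2) - h z)) :
    subderiv f x w ≤ subderiv h z v := by
  have hpos : ∀ᶠ p : ℝ × F in 𝓝[>] (0 : ℝ) ×ˢ 𝓝 v, 0 < p.1 :=
    tendsto_fst.eventually self_mem_nhdsWithin
  have ht : Tendsto (fun p : ℝ × F => (p.1, φ p)) (𝓝[>] (0 : ℝ) ×ˢ 𝓝 v)
      (𝓝[>] (0 : ℝ) ×ˢ 𝓝 w) := tendsto_fst.prodMk hφ
  exact ht.liminf_le_liminf_comp.trans
    (liminf_le_liminf (hpos.mono fun p hp => hle p hp))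

theorem sum_mul_le_subderiv_of_subgradient {ι : Type*} [Fintype ι] {θ : (ι → ℝ) → EReal}
    {x y : ι → ℝ} {c : ℝ} (hc : θ x = (c : EReal))
    (hy : ∀ z, θ x + ((∑ i, y i * (z i - x i) : ℝ) : EReal) ≤ θ z) (d : ι → ℝ) :
    ((∑ i, y i * d i : ℝ) : EReal) ≤ subderiv θ x d := by
  have hpos : ∀ᶠ p : ℝ × (ι → ℝ) in 𝓝[>] (0 : ℝ) ×ˢ 𝓝 d, 0 < p.1 :=
    tendsto_fst.eventually self_mem_nhdsWithin
  have hlim : Tendsto (fun p : ℝ × (ι → ℝ) => ((∑ i, y i * p.2 i : ℝ) : EReal))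
      (𝓝[>] (0 : ℝ) ×ˢ 𝓝 d) (𝓝 ((∑ i, y i * d i : ℝ) : EReal)) := by
    have h1 : Continuous fun v : ι → ℝ => ((∑ i, y i * v i : ℝ) : EReal) :=
      continuous_coe_real_ereal.comp (by fun_prop)
    exact (h1.tendsto d).comp tendsto_snd
  rw [← hlim.liminf_eq]
  refine liminf_le_liminf (hpos.mono fun p hp => ?_)
  have hsub := hy (x + p.1 • p.2)
  rw [hc] at hsub ⊢
  have hsum : ∑ i, y i * ((x + p.1 • p.2) i - x i) = p.1 * ∑ i, y i * p.2 i := by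
    rw [Finset.mul_sum]
    exact Finset.sum_congr rfl fun i _ => by simp; ring
  rw [hsum] at hsub
  generalize θ (x + p.1 • p.2) = e at hsub ⊢
  induction e with
  | bot => exact absurd (le_bot_iff.mp hsub) (by rw [← EReal.coe_add]; exact EReal.coe_ne_bot _)
  | top => rw [EReal.inv_coe_mul_top_sub hp]; exact le_top
  | coe e =>
    norm_cast at hsub ⊢
    rw [inv_mul_eq_div, le_div_iff₀ hp]
    linarith

end Subderivative

section Spectral

variable {n : ℕ} {θ : (Fin n → ℝ) → EReal} {lam : Matrix (Fin n) (Fin n) ℝ → Fin n → ℝ}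
  {g : Matrix (Fin n) (Fin n) ℝ → EReal}

theorem spectral_apply_conj_diagonal
    (hθsym : ∀ (σ : Equiv.Perm (Fin n)) (x : Fin n → ℝ), θ (x ∘ σ) = θ x)
    (hlam : ∀ X : Matrix (Fin n) (Fin n) ℝ, X.IsSymm → IsEigVec X (lam X))
    (hg : ∀ X : Matrix (Fin n) (Fin n) ℝ, g X = if X.IsSymm then θ (lam X) else ⊤)
    {W : Matrix (Fin n) (Fin n) ℝ} (hW : W * Wᵀ = 1) (z : Fin n → ℝ) :
    g (W * diagonal z * Wᵀ) = θ z := by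
  have hs := isSymm_conj_diagonal W z
  rw [hg, if_pos hs]
  obtain ⟨-, V, hV, hVeq⟩ := hlam _ hs
  obtain ⟨σ, hσ⟩ := exists_perm_of_conj_diagonal_eq hV hW hVeq.symm
  rw [hσ, hθsym]

/-- The eigenvalue map is Lipschitz on symmetric matrices. -/
theorem abs_lam_sub_le
    (hlam : ∀ X : Matrix (Fin n) (Fin n) ℝ, X.IsSymm → IsEigVec X (lam X))
    {A B : Matrix (Fin n) (Fin n) ℝ} (hA : A.IsSymm) (hB : B.IsSymm) (i : Fin n) :
    |lam A i - lam B i| ≤ √(trace ((A - B) * (A - B))) := by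
  obtain ⟨ha, V, hV, hAV⟩ := hlam A hA
  obtain ⟨hb, W, hW, hBW⟩ := hlam B hB
  refine Real.abs_le_sqrt ((Finset.single_le_sum (f := fun i => (lam A i - lam B i) ^ 2)
    (fun _ _ => sq_nonneg _) (Finset.mem_univ i)).trans ?_)
  exact sum_sq_sub_le_trace ha hb hV hW hAV hBW

/-- The chain rule for subderivatives of spectral functions, first half. -/
theorem subderiv_symmetric_le_subderiv_spectral
    (hlam : ∀ X : Matrix (Fin n) (Fin n) ℝ, X.IsSymm → IsEigVec X (lam X))
    (hg : ∀ X : Matrix (Fin n) (Fin n) ℝ, g X = if X.IsSymm then θ (lam X) else ⊤)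
    {X H : Matrix (Fin n) (Fin n) ℝ} (hX : X.IsSymm) (hH : H.IsSymm) {c : ℝ}
    (hgX : g X = (c : EReal)) {d : Fin n → ℝ}
    (hd : ∀ i, Tendsto (fun t : ℝ => (lam (X + t • H) i - lam X i) / t) (𝓝[>] 0) (𝓝 (d i))) :
    subderiv θ (lam X) d ≤ subderiv g X H := by
  classical
  have hθX : θ (lam X) = (c : EReal) := by rw [← hgX, hg, if_pos hX]
  refine subderiv_le_of_tendsto (φ := fun p => if p.2.IsSymm then
    fun i => (lam (X + p.1 • p.2) i - lam X i) / p.1 else d) ?_ ?_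
  · rw [tendsto_pi_nhds]
    intro i
    rw [tendsto_iff_dist_tendsto_zero]
    have hquot : Tendsto (fun p : ℝ × Matrix (Fin n) (Fin n) ℝ =>
        |(lam (X + p.1 • H) i - lam X i) / p.1 - d i|) (𝓝[>] 0 ×ˢ 𝓝 H) (𝓝 0) := by
      have := ((hd i).sub_const (d i)).abs
      rw [sub_self, abs_zero] at this
      exact this.comp tendsto_fst
    have htr : Tendsto (fun p : ℝ × Matrix (Fin n) (Fin n) ℝ =>
        √(trace ((p.2 - H) * (p.2 - H)))) (𝓝[>] 0 ×ˢ 𝓝 H) (𝓝 0) := by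
      have hcont : Continuous fun M : Matrix (Fin n) (Fin n) ℝ =>
          √(trace ((M - H) * (M - H))) := by fun_prop
      have := hcont.tendsto H
      simp only [sub_self, Matrix.mul_zero, trace_zero, Real.sqrt_zero] at this
      exact this.comp tendsto_snd
    have hsum := hquot.add htr
    rw [add_zero] at hsum
    refine squeeze_zero' (Eventually.of_forall fun _ => dist_nonneg) ?_ hsum
    filter_upwards [tendsto_fst.eventually (self_mem_nhdsWithin (a := (0 : ℝ)) (s := Ioi 0))]
      with p (hp : 0 < p.1)
    by_cases hs : p.2.IsSymm
    · rw [if_pos hs, Real.dist_eq]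
      have hlip := abs_lam_sub_le hlam (hX.add (hs.smul p.1)) (hX.add (hH.smul p.1)) i
      have hdiff : X + p.1 • p.2 - (X + p.1 • H) = p.1 • (p.2 - H) := by
        rw [smul_sub]; abel
      rw [hdiff, Matrix.smul_mul, Matrix.mul_smul, smul_smul, trace_smul, smul_eq_mul,
        Real.sqrt_mul (mul_self_nonneg _), Real.sqrt_mul_self hp.le] at hlip
      have hsplit : (lam (X + p.1 • p.2) i - lam X i) / p.1 - d i
          = ((lam (X + p.1 • H) i - lam X i) / p.1 - d i)
            + (lam (X + p.1 • p.2) i - lam (X + p.1 • H) i) / p.1 := by ring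
      rw [hsplit]
      refine (abs_add_le _ _).trans (add_le_add le_rfl ?_)
      rw [abs_div, abs_of_pos hp, div_le_iff₀ hp, mul_comm]
      exact hlip
    · rw [if_neg hs, dist_self]
      positivity
  · intro p hp
    by_cases hs : p.2.IsSymm
    · have harg : lam X + p.1 • (fun i => (lam (X + p.1 • p.2) i - lam X i) / p.1)
          = lam (X + p.1 • p.2) := by
        ext i
        simp only [Pi.add_apply, Pi.smul_apply, smul_eq_mul]
        rw [mul_div_cancel₀ _ hp.ne']
        ring
      rw [if_pos hs, harg, hθX, hgX, hg, if_pos (hX.add (hs.smul p.1))]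
    · have hns : ¬ (X + p.1 • p.2).IsSymm := by
        intro h
        apply hs
        have h1 := (h.sub hX).smul (p.1)⁻¹
        rwa [add_sub_cancel_left, smul_smul, inv_mul_cancel₀ hp.ne', one_smul] at h1
      rw [hg (X + p.1 • p.2), if_neg hns, hgX, EReal.inv_coe_mul_top_sub hp]
      exact le_top

/-- The chain rule for subderivatives of spectral functions, second half. -/
theorem subderiv_spectral_le_subderiv_symmetric
    (hθsym : ∀ (σ : Equiv.Perm (Fin n)) (x : Fin n → ℝ), θ (x ∘ σ) = θ x)
    (hlam : ∀ X : Matrix (Fin n) (Fin n) ℝ, X.IsSymm → IsEigVec X (lam X))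
    (hg : ∀ X : Matrix (Fin n) (Fin n) ℝ, g X = if X.IsSymm then θ (lam X) else ⊤)
    {X H : Matrix (Fin n) (Fin n) ℝ} (hX : X.IsSymm) (hH : H.IsSymm) {d : Fin n → ℝ}
    (hd : ∀ i, Tendsto (fun t : ℝ => (lam (X + t • H) i - lam X i) / t) (𝓝[>] 0) (𝓝 (d i))) :
    subderiv g X H ≤ subderiv θ (lam X) d := by
  have hdec : ∀ t : ℝ, ∃ V : Matrix (Fin n) (Fin n) ℝ, V * Vᵀ = 1 ∧
      X + t • H = V * diagonal (lam (X + t • H)) * Vᵀ :=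
    fun t => (hlam _ (hX.add (hH.smul t))).2
  choose V hV hVeq using hdec
  refine subderiv_le_of_tendsto (φ := fun p => H + V p.1 *
    diagonal (fun i => p.2 i - (lam (X + p.1 • H) i - lam X i) / p.1) * (V p.1)ᵀ) ?_ ?_
  · have hquot : ∀ k, Tendsto (fun p : ℝ × (Fin n → ℝ) =>
        |p.2 k - (lam (X + p.1 • H) k - lam X k) / p.1|) (𝓝[>] 0 ×ˢ 𝓝 d) (𝓝 0) := by
      intro k
      have h1 : Tendsto (fun p : ℝ × (Fin n → ℝ) => p.2 k) (𝓝[>] 0 ×ˢ 𝓝 d) (𝓝 (d k)) :=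
        ((continuous_apply k).tendsto d).comp tendsto_snd
      have h2 := (h1.sub ((hd k).comp tendsto_fst)).abs
      rwa [sub_self, abs_zero] at h2
    have hzero : Tendsto (fun p : ℝ × (Fin n → ℝ) => V p.1 *
        diagonal (fun i => p.2 i - (lam (X + p.1 • H) i - lam X i) / p.1) * (V p.1)ᵀ)
        (𝓝[>] 0 ×ˢ 𝓝 d) (𝓝 0) := by
      refine tendsto_pi_nhds.mpr fun i => tendsto_pi_nhds.mpr fun j => ?_
      have hsum : Tendsto (fun p : ℝ × (Fin n → ℝ) =>
          ∑ k, |p.2 k - (lam (X + p.1 • H) k - lam X k) / p.1|) (𝓝[>] 0 ×ˢ 𝓝 d) (𝓝 0) := by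
        simpa using tendsto_finsetSum Finset.univ fun k _ => hquot k
      refine squeeze_zero_norm (fun p => ?_) hsum
      rw [conj_diagonal_apply, Real.norm_eq_abs]
      refine (Finset.abs_sum_le_sum_abs _ _).trans (Finset.sum_le_sum fun k _ => ?_)
      rw [abs_mul, abs_mul]
      have h1 := abs_entry_le_one_of_orthogonal (hV p.1) i k
      have h2 := abs_entry_le_one_of_orthogonal (hV p.1) j k
      refine (mul_le_of_le_one_right (by positivity) h2).trans ?_
      exact mul_le_of_le_one_left (abs_nonneg _) h1
    simpa using hzero.const_add H
  · intro p hp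
    have harg : X + p.1 • (H + V p.1 *
        diagonal (fun i => p.2 i - (lam (X + p.1 • H) i - lam X i) / p.1) * (V p.1)ᵀ)
        = V p.1 * diagonal (lam X + p.1 • p.2) * (V p.1)ᵀ := by
      have hdiag : diagonal (lam X + p.1 • p.2) = diagonal (lam (X + p.1 • H)) +
          p.1 • diagonal (fun i => p.2 i - (lam (X + p.1 • H) i - lam X i) / p.1) := by
        rw [← diagonal_smul, diagonal_add]
        congr 1
        ext i
        simp only [Pi.add_apply, Pi.smul_apply, smul_eq_mul]
        field_simp
        ring
      rw [hdiag, Matrix.mul_add, Matrix.add_mul, ← hVeq, smul_add, Matrix.mul_smul,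
        Matrix.smul_mul, add_assoc]
    rw [harg, spectral_apply_conj_diagonal hθsym hlam hg (hV p.1), hg X, if_pos hX]

end Spectral

/-- characterization of the critical cone of a convex spectral function:
H ∈ K_g(X,Y) iff λ′(X;H) ∈ K_θ(λ(X),λ(Y)) and, for each eigenvalue block α_m of X,
Λ(Y)_{α_m α_m} and U_{α_m}ᵀ H U_{α_m} admit a simultaneous ordered spectral
decomposition. -/
theorem critical_cone_spectral {n : ℕ}
    (θ : (Fin n → ℝ) → EReal)
    (hθsym : ∀ (σ : Equiv.Perm (Fin n)) (x : Fin n → ℝ), θ (x ∘ σ) = θ x)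
    (hθbot : ∀ x, θ x ≠ ⊥)
    (lam : Matrix (Fin n) (Fin n) ℝ → Fin n → ℝ)
    (hlam : ∀ X : Matrix (Fin n) (Fin n) ℝ, X.IsSymm → IsEigVec X (lam X))
    (g : Matrix (Fin n) (Fin n) ℝ → EReal)
    (hg : ∀ X : Matrix (Fin n) (Fin n) ℝ, g X = if X.IsSymm then θ (lam X) else ⊤)
    (hlsc : LowerSemicontinuous g)
    (hconv : ∀ (A B : Matrix (Fin n) (Fin n) ℝ) (s t : ℝ), 0 ≤ s → 0 ≤ t → s + t = 1 →
      g (s • A + t • B) ≤ ((s : ℝ) : EReal) * g A + ((t : ℝ) : EReal) * g B)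
    (X Y : Matrix (Fin n) (Fin n) ℝ) (hXs : X.IsSymm) (hYs : Y.IsSymm)
    (c : ℝ) (hgX : g X = (c : EReal))
    (hYsub : ∀ Z : Matrix (Fin n) (Fin n) ℝ,
      g X + ((mInner Y (Z - X) : ℝ) : EReal) ≤ g Z)
    (U : Matrix (Fin n) (Fin n) ℝ) (hU : U * Uᵀ = 1)
    (hUX : X = U * Matrix.diagonal (lam X) * Uᵀ)
    (hUY : Y = U * Matrix.diagonal (lam Y) * Uᵀ)
    (H : Matrix (Fin n) (Fin n) ℝ) (hHs : H.IsSymm)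
    (d : Fin n → ℝ)
    (hd : ∀ i, Filter.Tendsto (fun t : ℝ => (lam (X + t • H) i - lam X i) / t)
      (nhdsWithin 0 (Set.Ioi 0)) (nhds (d i))) :
    subderiv g X H = ((mInner Y H : ℝ) : EReal) ↔
      (subderiv θ (lam X) d = ((∑ i, lam Y i * d i : ℝ) : EReal) ∧
        ∀ μ : ℝ, SimOrdDecomp
          ((Matrix.diagonal (lam Y)).submatrix
            (fun i : {i : Fin n // lam X i = μ} => (i : Fin n))
            (fun j : {i : Fin n // lam X i = μ} => (j : Fin n)))
          ((Uᵀ * H * U).submatrix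
            (fun i : {i : Fin n // lam X i = μ} => (i : Fin n))
            (fun j : {i : Fin n // lam X i = μ} => (j : Fin n)))) := by
  have hθX : θ (lam X) = (c : EReal) := by rw [← hgX, hg, if_pos hXs]
  have hchain : subderiv g X H = subderiv θ (lam X) d :=
    le_antisymm (subderiv_spectral_le_subderiv_symmetric hθsym hlam hg hXs hHs hd)
      (subderiv_symmetric_le_subderiv_spectral hlam hg hXs hHs hgX hd)
  have hinner : ∀ M : Matrix (Fin n) (Fin n) ℝ,
      mInner Y M = ∑ i, lam Y i * (Uᵀ * M * U) i i := by
    intro M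
    have h1 : trace (Y * M) = trace (diagonal (lam Y) * (Uᵀ * M * U)) := by
      conv_lhs => rw [hUY]
      rw [Matrix.mul_assoc, Matrix.mul_assoc, trace_mul_comm]
      simp only [Matrix.mul_assoc]
    rw [mInner, h1]
    simp [trace, diagonal_mul]
  have hUU := transpose_mul_self_of_orthogonal hU
  have hsubθ : ((∑ i, lam Y i * d i : ℝ) : EReal) ≤ subderiv θ (lam X) d := by
    refine sum_mul_le_subderiv_of_subgradient hθX (fun z => ?_) d
    have h1 := hYsub (U * diagonal z * Uᵀ)
    rw [spectral_apply_conj_diagonal hθsym hlam hg hU, hgX, ← hθX, hinner] at h1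
    have h2 : Uᵀ * (U * diagonal z * Uᵀ - X) * U = diagonal (fun i => z i - lam X i) := by
      conv_lhs => rw [hUX]
      rw [← Matrix.sub_mul, ← Matrix.mul_sub, Matrix.mul_assoc, Matrix.mul_assoc, hUU,
        Matrix.mul_one, ← Matrix.mul_assoc, hUU, Matrix.one_mul, diagonal_sub]
    simpa [h2] using h1
  have hdec : ∀ t : ℝ, ∃ V : Matrix (Fin n) (Fin n) ℝ, V * Vᵀ = 1 ∧
      X + t • H = V * diagonal (lam (X + t • H)) * Vᵀ :=
    fun t => (hlam _ (hXs.add (hHs.smul t))).2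
  choose V hV hVeq using hdec
  have hXU : diagonal (lam X) = Uᵀ * X * U := by
    conv_rhs => rw [hUX]
    rw [Matrix.mul_assoc, Matrix.mul_assoc _ Uᵀ, hUU, Matrix.mul_one, ← Matrix.mul_assoc, hUU,
      Matrix.one_mul]
  obtain ⟨Q, hQ, hQ0, hKQ⟩ := exists_limit_eigenbasis (x := lam X) (d := d) (K := Uᵀ * H * U)
    (l := fun t => lam (X + t • H)) (W := fun t => Uᵀ * V t)
    (fun t => mul_transpose_orthogonal hU (hV t)) (fun t => by
      have h1 : diagonal (lam X) + t • (Uᵀ * H * U) = Uᵀ * (X + t • H) * U := by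
        rw [hXU, Matrix.mul_add, Matrix.add_mul, Matrix.mul_smul, Matrix.smul_mul]
      have h2 : (X + t • H) * V t = V t * diagonal (lam (X + t • H)) := by
        conv_lhs => rw [hVeq t]
        rw [Matrix.mul_assoc, transpose_mul_self_of_orthogonal (hV t), Matrix.mul_one]
      rw [h1, Matrix.mul_assoc, ← Matrix.mul_assoc U, hU, Matrix.one_mul, Matrix.mul_assoc, h2,
        Matrix.mul_assoc]) hd
  have hd_sorted : ∀ i j, lam X i = lam X j → i ≤ j → d j ≤ d i := by
    intro i j hij hle
    refine le_of_tendsto_of_tendsto (hd j) (hd i) ?_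
    filter_upwards [self_mem_nhdsWithin] with t (ht : 0 < t)
    rw [hij]
    have := (hlam _ (hXs.add (hHs.smul t))).1 i j hle
    gcongr
  obtain ⟨hle, hiff⟩ := sum_mul_diag_le_and_eq_iff_blocks (hlam Y hYs).1 hd_sorted hQ hQ0 hKQ
  rw [← hiff, hchain, hinner H]
  constructor
  · intro h
    rw [h, EReal.coe_le_coe_iff] at hsubθ
    have heq := le_antisymm hle hsubθ
    exact ⟨by rw [h, heq], heq⟩
  · rintro ⟨h1, h2⟩
    rw [h1, h2]
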